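/- Suppose each buyer has ρ_i ∈ [0,1] (for ρ_i = 0, Σ_j a_ij = 1). Fix the Cobb-Douglas buyers' spending at their equilibrium values b*_{=0} (b*_ij = e_i a_ij for ρ_i = 0), and let b*_{>0} be the minimizer of Φ(·, b*_{=0}) over feasible spendings of the ρ_i > 0 buyers, corresponding to the market equilibrium. Define the allocation x(b) by x_ij(b) = b_ij / p_j(b) and the Eisenberg-Gale objective Ψ(x) = Σ_i e_i log u_i(x_i), where u_i(x_i) = (Σ_j a_ij x_ij^{ρ_i})^{1/ρ_i} for ρ_i > 0 and u_i(x_i) = Π_j x_ij^{a_ij} for ρ_i = 0. Then for every entrywise positive feasible spending b_{>0} of the ρ_i > 0 buyers: Ψ(x(b*_{>0}, b*_{=0})) − Ψ(x(b_{>0}, b*_{=0})) ≤ Φ(b_{>0}, b*_{=0}) − Φ(b*_{>0}, b*_{=0}). -/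

import Mathlib

open Finset

/-- Price of good `j` given spending `b`. -/
noncomputable def price {m n : ℕ} (b : Fin m → Fin n → ℝ) (j : Fin n) : ℝ :=
  ∑ i, b i j

/-- KL divergence between two nonnegative vectors. -/
noncomputable def KL {n : ℕ} (x y : Fin n → ℝ) : ℝ :=
  ∑ j, x j * Real.log (x j / y j)

/-- Feasible spending: nonnegative entries, each buyer spends exactly her budget. -/
def Feasible {m n : ℕ} (e : Fin m → ℝ) (b : Fin m → Fin n → ℝ) : Prop :=
  ∀ i, (∀ j, 0 ≤ b i j) ∧ ∑ j, b i j = e i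

/-- `mix S b b'` takes buyer `i`'s spending from `b` when `i ∈ S`, else from `b'`. -/
def mix {m n : ℕ} (S : Finset (Fin m)) (b b' : Fin m → Fin n → ℝ) :
    Fin m → Fin n → ℝ :=
  fun i => if i ∈ S then b i else b' i

/-- The potential `Φ`, where `S` is the set of buyers with `ρ_i ≠ 0` and its
complement consists of the Cobb-Douglas buyers (`ρ_i = 0`), who contribute the
term `Σ_j b_ij log p_j(b)`. -/
noncomputable def PhiCD {m n : ℕ} (S : Finset (Fin m))
    (a : Fin m → Fin n → ℝ) (ρ : Fin m → ℝ) (b : Fin m → Fin n → ℝ) : ℝ :=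
  (-∑ i ∈ S,
      (1 / ρ i) * ∑ j, b i j * Real.log (a i j * b i j ^ (ρ i - 1) / price b j ^ ρ i)) +
    ∑ i ∈ Sᶜ, ∑ j, b i j * Real.log (price b j)

/-- The allocation induced by spending `b`: `x_ij = b_ij / p_j(b)`. -/
noncomputable def alloc {m n : ℕ} (b : Fin m → Fin n → ℝ) :
    Fin m → Fin n → ℝ :=
  fun i j => b i j / price b j

/-- The Eisenberg-Gale objective `Ψ(x) = Σ_i e_i log u_i(x_i)`, where buyers in `P`
have CES utilities with parameter `ρ_i > 0` and the remaining buyers are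
Cobb-Douglas. -/
noncomputable def PsiEG {m n : ℕ} (P : Finset (Fin m)) (e : Fin m → ℝ)
    (a : Fin m → Fin n → ℝ) (ρ : Fin m → ℝ) (x : Fin m → Fin n → ℝ) : ℝ :=
  (∑ i ∈ P, e i * Real.log ((∑ j, a i j * x i j ^ ρ i) ^ (1 / ρ i))) +
    ∑ i ∈ Pᶜ, e i * Real.log (∏ j, x i j ^ a i j)

lemma price_pos_of_pos {m n : ℕ} {b : Fin m → Fin n → ℝ} (hb : ∀ i j, 0 ≤ b i j)
    {i : Fin m} {j : Fin n} (h : 0 < b i j) : 0 < price b j :=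
  Finset.sum_pos' (fun i _ => hb i j) ⟨i, Finset.mem_univ i, h⟩

/-- The potential as a separable function of prices and spending. -/
lemma PhiCD_eq_sum_mul_log {m n : ℕ} {S : Finset (Fin m)} {a : Fin m → Fin n → ℝ}
    {ρ : Fin m → ℝ} {b : Fin m → Fin n → ℝ} (ha : ∀ i j, 0 < a i j)
    (hρ : ∀ i ∈ S, 0 < ρ i) (hb : ∀ i j, 0 ≤ b i j) :
    PhiCD S a ρ b = ∑ j, price b j * Real.log (price b j) +
      ∑ i ∈ S, ∑ j, ((1 - ρ i) / ρ i * (b i j * Real.log (b i j)) -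
        b i j * (Real.log (a i j) / ρ i)) := by
  have hprice : ∑ j, price b j * Real.log (price b j) =
      ∑ i ∈ S, ∑ j, b i j * Real.log (price b j) +
        ∑ i ∈ Sᶜ, ∑ j, b i j * Real.log (price b j) := by
    rw [Finset.sum_add_sum_compl, Finset.sum_comm]
    exact Finset.sum_congr rfl fun j _ => Finset.sum_mul _ _ _
  have hterm : ∀ i ∈ S, -((1 / ρ i) *
      ∑ j, b i j * Real.log (a i j * b i j ^ (ρ i - 1) / price b j ^ ρ i)) =
      ∑ j, b i j * Real.log (price b j) +
      ∑ j, ((1 - ρ i) / ρ i * (b i j * Real.log (b i j)) -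
        b i j * (Real.log (a i j) / ρ i)) := by
    intro i hi
    rw [Finset.mul_sum, ← Finset.sum_neg_distrib, ← Finset.sum_add_distrib]
    refine Finset.sum_congr rfl fun j _ => ?_
    rcases (hb i j).eq_or_lt with h0 | h0
    · simp [← h0]
    have hp := price_pos_of_pos hb h0
    have hr := hρ i hi
    rw [Real.log_div (mul_pos (ha i j) (Real.rpow_pos_of_pos h0 _)).ne'
      (Real.rpow_pos_of_pos hp _).ne',
      Real.log_mul (ha i j).ne' (Real.rpow_pos_of_pos h0 _).ne',
      Real.log_rpow h0, Real.log_rpow hp]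
    field_simp
    ring
  rw [PhiCD, hprice, ← Finset.sum_neg_distrib, Finset.sum_congr rfl hterm,
    Finset.sum_add_distrib]
  ring

lemma hasDerivAt_add_mul_mul_log {x d : ℝ} (h : x ≠ 0 ∨ d = 0) :
    HasDerivAt (fun t : ℝ => (x + t * d) * Real.log (x + t * d))
      ((Real.log x + 1) * d) 0 := by
  rcases h with h | rfl
  · have hin : HasDerivAt (fun t : ℝ => x + t * d) d 0 := by
      simpa using ((hasDerivAt_id (0 : ℝ)).mul_const d).const_add x
    have hout : HasDerivAt (fun y : ℝ => y * Real.log y) (Real.log x + 1) (x + 0 * d) := by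
      simpa using Real.hasDerivAt_mul_log h
    exact hout.comp (0 : ℝ) hin
  · simpa using hasDerivAt_const (0 : ℝ) (x * Real.log x)

/-- First-order condition at a minimizer of the potential: the bang-per-buck
`a_ij b_ij^(ρ_i - 1) / p_j^ρ_i` of a buyer is the same on all goods she spends on. -/
lemma ratio_eq_of_minimizer {m n : ℕ} {P : Finset (Fin m)} {e : Fin m → ℝ}
    {a : Fin m → Fin n → ℝ} (ha : ∀ i j, 0 < a i j) {ρ : Fin m → ℝ}
    (hρ : ∀ i ∈ P, 0 < ρ i) {b : Fin m → Fin n → ℝ} (hb : Feasible e b)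
    (hmin : ∀ b', Feasible e b' → PhiCD P a ρ b ≤ PhiCD P a ρ (mix P b' b))
    {i : Fin m} (hi : i ∈ P) {j k : Fin n} (hj : 0 < b i j) (hk : 0 < b i k) :
    a i j * b i j ^ (ρ i - 1) / price b j ^ ρ i =
      a i k * b i k ^ (ρ i - 1) / price b k ^ ρ i := by
  rcases eq_or_ne j k with rfl | hjk
  · rfl
  have hb0 : ∀ i j, 0 ≤ b i j := fun i => (hb i).1
  let D : Fin n → ℝ := fun l => (if l = j then 1 else 0) - (if l = k then 1 else 0)
  let d : Fin m → Fin n → ℝ := fun i' l => if i' = i then D l else 0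
  let B : ℝ → Fin m → Fin n → ℝ := fun t i' l => b i' l + t * d i' l
  have hB0 : ∀ t, |t| < min (b i j) (b i k) → ∀ i' l, 0 ≤ B t i' l := by
    intro t ht i' l
    have h1 := abs_lt.1 (ht.trans_le (min_le_left _ _))
    have h2 := abs_lt.1 (ht.trans_le (min_le_right _ _))
    simp only [B, d, D]
    by_cases h : i' = i
    · subst h
      by_cases hlj : l = j
      · subst hlj
        simp [hjk]
        linarith
      · by_cases hlk : l = k
        · subst hlk
          simp [hlj]
          linarith
        · simp [hlj, hlk, hb0]
    · simp [h, hb0]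
  have hBsum : ∀ t i', ∑ l, B t i' l = e i' := by
    intro t i'
    by_cases h : i' = i <;>
      simp [B, d, D, h, Finset.sum_add_distrib, ← Finset.mul_sum, (hb _).2]
  have hmix : ∀ t, mix P (B t) b = B t := by
    intro t
    funext i' l
    by_cases h : i' ∈ P
    · simp [mix, h]
    · have : i' ≠ i := fun h' => h (h' ▸ hi)
      simp [mix, h, B, d, this]
  have hprice : ∀ t l, price (B t) l = price b l + t * D l := by
    intro t l
    simp [price, B, d, Finset.sum_add_distrib]
  let F : ℝ → ℝ := fun t =>
    ∑ l, (price b l + t * D l) * Real.log (price b l + t * D l) +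
      ∑ i' ∈ P, ∑ l, ((1 - ρ i') / ρ i' *
        ((b i' l + t * d i' l) * Real.log (b i' l + t * d i' l)) -
        (b i' l + t * d i' l) * (Real.log (a i' l) / ρ i'))
  have hF : ∀ t, |t| < min (b i j) (b i k) → PhiCD P a ρ (B t) = F t := by
    intro t ht
    rw [PhiCD_eq_sum_mul_log ha hρ (hB0 t ht)]
    simp only [hprice, F, B]
  have hr : 0 < min (b i j) (b i k) := lt_min hj hk
  have hlocal : IsLocalMin F 0 := by
    filter_upwards [Metric.ball_mem_nhds (0 : ℝ) hr] with t ht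
    rw [Metric.mem_ball, dist_zero_right, Real.norm_eq_abs] at ht
    rw [← hF t ht, ← hF 0 (by simpa using hr)]
    have h := hmin (B t) fun i' => ⟨hB0 t ht i', hBsum t i'⟩
    rw [hmix] at h
    simpa [B] using h
  have hDne : ∀ l, 0 < b i l ∨ D l = 0 := by
    intro l
    by_cases hlj : l = j
    · exact Or.inl (hlj ▸ hj)
    · by_cases hlk : l = k
      · exact Or.inl (hlk ▸ hk)
      · exact Or.inr (by simp [D, hlj, hlk])
  have hderiv : HasDerivAt F (∑ l, (Real.log (price b l) + 1) * D l +
      ∑ i' ∈ P, ∑ l, ((1 - ρ i') / ρ i' * ((Real.log (b i' l) + 1) * d i' l) -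
        d i' l * (Real.log (a i' l) / ρ i'))) 0 := by
    refine HasDerivAt.add (HasDerivAt.fun_sum fun l _ => ?_)
      (HasDerivAt.fun_sum fun i' _ => HasDerivAt.fun_sum fun l _ => ?_)
    · exact hasDerivAt_add_mul_mul_log
        ((hDne l).imp_left fun h => (price_pos_of_pos hb0 h).ne')
    · refine HasDerivAt.sub ((hasDerivAt_add_mul_mul_log ?_).const_mul _) ?_
      · by_cases h : i' = i
        · subst h
          simpa [d] using (hDne l).imp_left fun h => h.ne'
        · exact Or.inr (by simp [d, h])
      · have hin : HasDerivAt (fun t : ℝ => b i' l + t * d i' l) (d i' l) 0 := by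
          simpa using ((hasDerivAt_id (0 : ℝ)).mul_const (d i' l)).const_add (b i' l)
        exact hin.mul_const _
  have hzero := hlocal.hasDerivAt_eq_zero hderiv
  rw [Finset.sum_eq_single_of_mem i hi (fun i' _ h => by simp [d, h])] at hzero
  simp only [d, D, if_true, mul_sub, sub_mul, Finset.sum_sub_distrib, mul_ite, ite_mul,
    mul_one, mul_zero, one_mul, zero_mul, Finset.sum_ite_eq', Finset.mem_univ] at hzero
  have hlog : ∀ l, 0 < b i l → Real.log (a i l * b i l ^ (ρ i - 1) / price b l ^ ρ i) =
      Real.log (a i l) + (ρ i - 1) * Real.log (b i l) - ρ i * Real.log (price b l) := by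
    intro l hl
    have hp := price_pos_of_pos hb0 hl
    rw [Real.log_div (mul_pos (ha i l) (Real.rpow_pos_of_pos hl _)).ne'
      (Real.rpow_pos_of_pos hp _).ne',
      Real.log_mul (ha i l).ne' (Real.rpow_pos_of_pos hl _).ne',
      Real.log_rpow hl, Real.log_rpow hp]
  have hpos : ∀ l, 0 < b i l → 0 < a i l * b i l ^ (ρ i - 1) / price b l ^ ρ i := fun l hl =>
    div_pos (mul_pos (ha i l) (Real.rpow_pos_of_pos hl _))
      (Real.rpow_pos_of_pos (price_pos_of_pos hb0 hl) _)
  refine Real.log_injOn_pos (hpos j hj) (hpos k hk) ?_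
  rw [hlog j hj, hlog k hk]
  have hρi := hρ i hi
  field_simp at hzero
  linarith

/-- A Gibbs inequality: concavity of `log` with unnormalized weights. -/
lemma sum_mul_log_le_mul_log_sum {ι : Type*} (s : Finset ι) {b w : ι → ℝ} {E : ℝ}
    (hE : 0 < E) (hb : ∀ j ∈ s, 0 ≤ b j) (hsum : ∑ j ∈ s, b j = E)
    (hw : ∀ j ∈ s, 0 < w j) :
    ∑ j ∈ s, b j * Real.log (w j) + E * Real.log E ≤
      E * Real.log (∑ j ∈ s, b j * w j) := by
  have hne : ∃ j ∈ s, 0 < b j := by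
    by_contra! h
    exact absurd (hsum ▸ Finset.sum_nonpos h) (not_le.2 hE)
  obtain ⟨k, hks, hk⟩ := hne
  have hT : 0 < ∑ j ∈ s, b j * w j :=
    Finset.sum_pos' (fun j hj => mul_nonneg (hb j hj) (hw j hj).le)
      ⟨k, hks, mul_pos hk (hw k hks)⟩
  have h := strictConcaveOn_log_Ioi.concaveOn.le_map_sum (t := s) (w := fun j => b j / E)
    (p := w) (fun j hj => div_nonneg (hb j hj) hE.le)
    (by rw [← Finset.sum_div, hsum, div_self hE.ne']) hw
  simp only [smul_eq_mul, div_mul_eq_mul_div, ← Finset.sum_div] at h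
  rw [Real.log_div hT.ne' hE.ne', div_le_iff₀ hE] at h
  linarith

lemma mul_alloc_rpow {m n : ℕ} {b : Fin m → Fin n → ℝ} (hb : ∀ i j, 0 ≤ b i j)
    {i : Fin m} {j : Fin n} {r : ℝ} (hr : 0 < r) (c : ℝ) :
    c * alloc b i j ^ r = b i j * (c * b i j ^ (r - 1) / price b j ^ r) := by
  rcases (hb i j).eq_or_lt with h0 | h0
  · simp [alloc, ← h0, Real.zero_rpow hr.ne']
  · rw [alloc, Real.div_rpow h0.le (price_pos_of_pos hb h0).le, Real.rpow_sub_one h0.ne']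
    field_simp

lemma log_utility_rpow {m n : ℕ} {a : Fin m → Fin n → ℝ} (ha : ∀ i j, 0 < a i j)
    {b : Fin m → Fin n → ℝ} (hb : ∀ i j, 0 ≤ b i j) {i : Fin m} {r : ℝ} (hr : 0 < r) :
    Real.log ((∑ j, a i j * alloc b i j ^ r) ^ (1 / r)) =
      1 / r * Real.log (∑ j, b i j * (a i j * b i j ^ (r - 1) / price b j ^ r)) := by
  rcases (Finset.sum_nonneg (s := Finset.univ) fun j _ => mul_nonneg (ha i j).le
    (Real.rpow_nonneg (div_nonneg (hb i j) (Finset.sum_nonneg fun i _ => hb i j)) r)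
    : 0 ≤ ∑ j, a i j * alloc b i j ^ r).eq_or_lt with h | h
  · rw [← Finset.sum_congr rfl fun j _ => mul_alloc_rpow hb hr (a i j), ← h,
      Real.zero_rpow (by positivity)]
    simp
  · rw [Real.log_rpow h, Finset.sum_congr rfl fun j _ => mul_alloc_rpow hb hr (a i j)]

/-- The contribution of Cobb-Douglas buyers at their equilibrium spending to `Ψ + Φ`. -/
lemma cobbDouglas_add_potential {m n : ℕ} {e : Fin m → ℝ} (he : ∀ i, 0 < e i)
    {a : Fin m → Fin n → ℝ} (ha : ∀ i j, 0 < a i j) {b : Fin m → Fin n → ℝ}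
    (hb : ∀ i j, 0 ≤ b i j) {i : Fin m} (hi : ∀ j, b i j = e i * a i j) :
    e i * Real.log (∏ j, alloc b i j ^ a i j) + ∑ j, b i j * Real.log (price b j) =
      ∑ j, e i * a i j * Real.log (e i * a i j) := by
  have hbi : ∀ j, 0 < b i j := fun j => hi j ▸ mul_pos (he i) (ha i j)
  have hp : ∀ j, 0 < price b j := fun j => price_pos_of_pos hb (hbi j)
  have hx : ∀ j, 0 < alloc b i j := fun j => div_pos (hbi j) (hp j)
  rw [Real.log_prod fun j _ => (Real.rpow_pos_of_pos (hx j) (a i j)).ne',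
    Finset.mul_sum, ← Finset.sum_add_distrib]
  refine Finset.sum_congr rfl fun j _ => ?_
  rw [Real.log_rpow (hx j), alloc,
    Real.log_div (hbi j).ne' (hp j).ne', hi j]
  ring

/-- In the substitutes-plus-Cobb-Douglas domain, with the
Cobb-Douglas buyers fixed at their equilibrium spending, the Eisenberg-Gale
objective `Ψ` converges at least as fast as the potential `Φ`:
`Ψ(x(b*)) - Ψ(x(b_{>0}, b*_{=0})) ≤ Φ(b_{>0}, b*_{=0}) - Φ(b*)`. -/
theorem eisenberg_gale_dominated_by_potential {m n : ℕ}
    (P : Finset (Fin m))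
    (e : Fin m → ℝ) (he : ∀ i, 0 < e i)
    (a : Fin m → Fin n → ℝ) (ha : ∀ i j, 0 < a i j)
    (ρ : Fin m → ℝ) (hρ : ∀ i, 0 ≤ ρ i ∧ ρ i ≤ 1)
    (hP : ∀ i, i ∈ P ↔ 0 < ρ i)
    (hCD : ∀ i ∉ P, ∑ j, a i j = 1)
    -- b* : Cobb-Douglas buyers at equilibrium, and b*_{>0} minimizes Φ(·, b*_{=0})
    (bstar : Fin m → Fin n → ℝ) (hbstarFeas : Feasible e bstar)
    (hbstarCD : ∀ i ∉ P, ∀ j, bstar i j = e i * a i j)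
    (hbstarMin : ∀ b', Feasible e b' →
      PhiCD P a ρ bstar ≤ PhiCD P a ρ (mix P b' bstar)) :
    ∀ b' : Fin m → Fin n → ℝ, Feasible e b' → (∀ i ∈ P, ∀ j, 0 < b' i j) →
      PsiEG P e a ρ (alloc bstar) - PsiEG P e a ρ (alloc (mix P b' bstar)) ≤
        PhiCD P a ρ (mix P b' bstar) - PhiCD P a ρ bstar := by
  intro b' hb' hpos
  have hρP : ∀ i ∈ P, 0 < ρ i := fun i hi => (hP i).1 hi
  have hs0 : ∀ i j, 0 ≤ bstar i j := fun i => (hbstarFeas i).1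
  set c := mix P b' bstar with hc
  have hcP : ∀ i ∈ P, c i = b' i := fun i hi => by simp [hc, mix, hi]
  have hcC : ∀ i ∉ P, c i = bstar i := fun i hi => by simp [hc, mix, hi]
  have hc0 : ∀ i j, 0 ≤ c i j := fun i j => by
    by_cases hi : i ∈ P
    · exact hcP i hi ▸ (hb' i).1 j
    · exact hcC i hi ▸ hs0 i j
  let C : ℝ := ∑ i ∈ P, 1 / ρ i * (e i * Real.log (e i)) +
    ∑ i ∈ Pᶜ, ∑ j, e i * a i j * Real.log (e i * a i j)
  have split : ∀ b, PsiEG P e a ρ (alloc b) + PhiCD P a ρ b =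
      ∑ i ∈ P, (e i * Real.log ((∑ j, a i j * alloc b i j ^ ρ i) ^ (1 / ρ i)) -
        1 / ρ i * ∑ j, b i j * Real.log (a i j * b i j ^ (ρ i - 1) / price b j ^ ρ i)) +
      ∑ i ∈ Pᶜ, (e i * Real.log (∏ j, alloc b i j ^ a i j) +
        ∑ j, b i j * Real.log (price b j)) := by
    intro b
    rw [PsiEG, PhiCD, Finset.sum_sub_distrib, Finset.sum_add_distrib]
    ring
  have hstar : PsiEG P e a ρ (alloc bstar) + PhiCD P a ρ bstar = C := by
    rw [split]
    congr 1
    · refine Finset.sum_congr rfl fun i hi => ?_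
      obtain ⟨k, hk⟩ : ∃ k, 0 < bstar i k := by
        by_contra! h
        exact absurd ((hbstarFeas i).2 ▸ Finset.sum_nonpos fun j _ => h j) (not_le.2 (he i))
      set r := a i k * bstar i k ^ (ρ i - 1) / price bstar k ^ ρ i with hr
      have hr0 : 0 < r := div_pos (mul_pos (ha i k) (Real.rpow_pos_of_pos hk _))
        (Real.rpow_pos_of_pos (price_pos_of_pos hs0 hk) _)
      have heq (f : ℝ → ℝ) (j : Fin n) : bstar i j *
          f (a i j * bstar i j ^ (ρ i - 1) / price bstar j ^ ρ i) = bstar i j * f r := by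
        rcases (hs0 i j).eq_or_lt with h0 | h0
        · simp [← h0]
        · rw [ratio_eq_of_minimizer ha hρP hbstarFeas hbstarMin hi h0 hk]
      rw [log_utility_rpow ha hs0 (hρP i hi), Finset.sum_congr rfl fun j _ => heq (fun x => x) j,
        Finset.sum_congr rfl fun j _ => heq Real.log j, ← Finset.sum_mul, ← Finset.sum_mul,
        (hbstarFeas i).2, Real.log_mul (he i).ne' hr0.ne']
      ring
    · exact Finset.sum_congr rfl fun i hi =>
        cobbDouglas_add_potential he ha hs0 (hbstarCD i (Finset.mem_compl.1 hi))
  have hmixed : C ≤ PsiEG P e a ρ (alloc c) + PhiCD P a ρ c := by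
    rw [split]
    refine add_le_add (Finset.sum_le_sum fun i hi => ?_) (Finset.sum_le_sum fun i hi => ?_)
    · have hci : ∀ j, 0 < c i j := fun j => hcP i hi ▸ hpos i hi j
      rw [log_utility_rpow ha hc0 (hρP i hi)]
      have h := sum_mul_log_le_mul_log_sum Finset.univ (he i) (fun j _ => hc0 i j)
        (hcP i hi ▸ (hb' i).2)
        (fun j _ => (div_pos (mul_pos (ha i j) (Real.rpow_pos_of_pos (hci j) (ρ i - 1)))
          (Real.rpow_pos_of_pos (price_pos_of_pos hc0 (hci j)) (ρ i))))
      have := mul_le_mul_of_nonneg_left h (one_div_pos.2 (hρP i hi)).le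
      linarith
    · have hi' := Finset.mem_compl.1 hi
      exact (cobbDouglas_add_potential he ha hc0 fun j => hcC i hi' ▸ hbstarCD i hi' j).ge
  linarith
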